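/- Let K ⊆ ℝ be a field that is a finitely generated extension of ℚ, and let r ∈ K with r > 0 and r ≠ 1. Then the set of natural numbers n ≥ 1 such that r^(1/n) ∈ K is finite, where r^(1/n) denotes the positive real n-th root of r. -/

import Mathlib

open Polynomial in
/-- If `r = s ^ n` is transcendental over `L`, then `1, s, …, s ^ (n - 1)` are linearly
independent over `L(r)`. -/
theorem linearIndependent_pow_of_transcendental_pow {L E : Type*} [Field L] [Field E] [Algebra L E]
    {s : E} {n : ℕ} (hr : Transcendental L (s ^ n)) :
    LinearIndependent (IntermediateField.adjoin L {s ^ n}) (fun i : Fin n ↦ s ^ (i : ℕ)) := by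
  open scoped IntermediateField.algebraAdjoinAdjoin in
  rw [← LinearIndependent.iff_fractionRing (Algebra.adjoin L {s ^ n}), Fintype.linearIndependent_iff]
  intro g hg i
  have hn : 0 < n := i.pos
  have hs : Transcendental L s := fun h ↦ hr (h.pow n)
  have hp (j : Fin n) : ∃ p : L[X], aeval (s ^ n) p = (g j : E) := by
    have : (g j : E) ∈ (aeval (s ^ n) : L[X] →ₐ[L] E).range :=
      Algebra.adjoin_singleton_eq_range_aeval L (s ^ n) ▸ (g j).2
    exact this
  choose p hp using hp
  have hzero : ∑ j, expand L n (p j) * X ^ (j : ℕ) = 0 := by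
    refine (transcendental_iff.mp hs) _ ?_
    rw [map_sum, ← hg]
    refine Finset.sum_congr rfl fun j _ ↦ ?_
    rw [map_mul, expand_aeval, hp, map_pow, aeval_X, Algebra.smul_def]
    rfl
  have hpi : p i = 0 := by
    ext m
    have hc := congrArg (fun q : L[X] ↦ q.coeff (m * n + i)) hzero
    simp only [finsetSum_coeff, coeff_zero] at hc
    rw [Finset.sum_eq_single i] at hc
    · simpa [coeff_mul_X_pow, coeff_expand_mul hn] using hc
    · intro j _ hji
      rw [coeff_mul_X_pow', coeff_expand hn]
      split_ifs with h₁ h₂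
      · exfalso
        apply hji
        have h₃ : m * n + i ≡ j [MOD n] := ((Nat.modEq_iff_dvd' h₁).mpr h₂).symm
        have h₄ : (i : ℕ) % n = j % n := by simpa [Nat.ModEq] using h₃
        rw [Nat.mod_eq_of_lt i.2, Nat.mod_eq_of_lt j.2] at h₄
        exact Fin.ext h₄.symm
      · rfl
      · rfl
    · simp
  ext
  rw [← hp, hpi, map_zero, ZeroMemClass.coe_zero]

/-- A transcendental element of a finitely generated field extension has `n`-th roots for only
finitely many `n`. -/
theorem finite_setOf_exists_pow_eq_of_transcendental {k E : Type*} [Field k] [Field E] [Algebra k E]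
    [Algebra.EssFiniteType k E] {r : E} (hr : Transcendental k r) :
    {n : ℕ | ∃ s : E, s ^ n = r}.Finite := by
  obtain ⟨S, hrS, hS⟩ := exists_isTranscendenceBasis_superset (R := k) (s := {r})
    ((algebraicIndependent_singleton_iff (⟨r, rfl⟩ : ({r} : Set E))).mpr hr)
  have hrS : r ∈ S := hrS rfl
  let L := IntermediateField.adjoin k (S \ {r})
  have hL : Transcendental L r := by
    rw [IntermediateField.transcendental_adjoin_iff]
    have := hS.1.transcendental_adjoin (s := {⟨r, hrS⟩}ᶜ) (i := ⟨r, hrS⟩) (by simp)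
    have himage : ((↑) : S → E) '' {⟨r, hrS⟩}ᶜ = S \ {r} := by
      ext
      simp [Set.image, and_comm]
    rwa [himage] at this
  have : Algebra.EssFiniteType L E := .of_comp k L E
  have : Algebra.EssFiniteType (IntermediateField.adjoin L {r}) E := .of_comp L _ E
  have : Algebra.IsAlgebraic (IntermediateField.adjoin L {r}) E := by
    have h : Algebra.IsAlgebraic ((IntermediateField.adjoin L {r}).restrictScalars k) E := by
      rw [IntermediateField.adjoin_adjoin_left, Set.sdiff_union_self,
        Set.union_eq_left.mpr (by simpa using hrS)]
      have := hS.isAlgebraic_field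
      rwa [Subtype.range_coe] at this
    exact h
  have : FiniteDimensional (IntermediateField.adjoin L {r}) E :=
    Algebra.finite_of_essFiniteType_of_isAlgebraic
  refine (Set.finite_Iic (Module.finrank (IntermediateField.adjoin L {r}) E)).subset ?_
  rintro n ⟨s, rfl⟩
  simpa using (linearIndependent_pow_of_transcendental_pow hL).fintype_card_le_finrank

/-- Elements algebraic over `k` that are linearly independent over `k` remain so over `k[x]`
for algebraically independent `x`. -/
theorem AlgebraicIndependent.linearIndependent_adjoin {k E ι m : Type*} [Field k] [Field E]
    [Algebra k E] {x : ι → E} (hx : AlgebraicIndependent k x) {v : m → algebraicClosure k E}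
    (hv : LinearIndependent k v) :
    LinearIndependent (Algebra.adjoin k (Set.range x)) (fun i ↦ (v i : E)) := by
  rw [linearIndependent_iff']
  intro t g hg i hi
  have hp (j : m) : ∃ p : MvPolynomial ι k, MvPolynomial.aeval x p = (g j : E) := by
    have : (g j : E) ∈ (MvPolynomial.aeval x : MvPolynomial ι k →ₐ[k] E).range :=
      Algebra.adjoin_range_eq_range_aeval k x ▸ (g j).2
    exact this
  choose p hp using hp
  have hzero : ∑ j ∈ t, v j • MvPolynomial.map (algebraMap k (algebraicClosure k E)) (p j) = 0 := by
    refine hx.algebraicClosure.eq_zero_of_aeval_eq_zero _ ?_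
    rw [map_sum, ← hg]
    refine Finset.sum_congr rfl fun j _ ↦ ?_
    rw [map_smul, MvPolynomial.aeval_map_algebraMap, hp, Algebra.smul_def, Algebra.smul_def,
      mul_comm]
    rfl
  have hpi : p i = 0 := by
    ext c
    have hc := congrArg (MvPolynomial.coeff c) hzero
    rw [MvPolynomial.coeff_sum, MvPolynomial.coeff_zero] at hc
    refine linearIndependent_iff'.mp hv t (fun j ↦ (p j).coeff c) ?_ i hi
    rw [← hc]
    refine Finset.sum_congr rfl fun j _ ↦ ?_
    rw [MvPolynomial.coeff_smul, MvPolynomial.coeff_map, Algebra.smul_def, smul_eq_mul, mul_comm]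
  ext
  rw [← hp, hpi, map_zero, ZeroMemClass.coe_zero]

/-- The relative algebraic closure of `k` in a finitely generated field extension is finite
over `k`. -/
theorem finiteDimensional_algebraicClosure_of_essFiniteType (k E : Type*) [Field k] [Field E]
    [Algebra k E] [Algebra.EssFiniteType k E] : FiniteDimensional k (algebraicClosure k E) := by
  obtain ⟨S, hS⟩ := exists_isTranscendenceBasis k E
  let M := IntermediateField.adjoin k (Set.range ((↑) : S → E))
  have : Algebra.EssFiniteType M E := .of_comp k M E
  have : Algebra.IsAlgebraic M E := hS.isAlgebraic_field
  have : FiniteDimensional M E :=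
    Algebra.finite_of_essFiniteType_of_isAlgebraic
  let b := Module.Basis.ofVectorSpace k (algebraicClosure k E)
  have hb := hS.1.linearIndependent_adjoin b.linearIndependent
  open scoped IntermediateField.algebraAdjoinAdjoin in
  rw [LinearIndependent.iff_fractionRing (Algebra.adjoin k (Set.range ((↑) : S → E))) M] at hb
  have := hb.finite
  exact b.finiteDimensional_of_finite

/-- In a number field, an element has only finitely many roots of any order. -/
theorem NumberField.finite_setOf_exists_pow_eq (F : Type*) [Field F] [NumberField F] (a : F) :
    {x : F | ∃ n ≠ 0, x ^ n = a}.Finite := by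
  have : Algebra.IsAlgebraic ℤ ℚ := IsLocalization.isAlgebraic ℚ (nonZeroDivisors ℤ)
  have : Algebra.IsAlgebraic ℤ F := .trans ℤ ℚ F
  obtain ⟨d, hd0, hd⟩ := (Algebra.IsAlgebraic.isAlgebraic (R := ℤ) a).exists_integral_multiple
  have hinj : Function.Injective (fun x : F ↦ d • x) := smul_right_injective F hd0
  let B : ℝ := max 1 (∑ φ : F →+* ℂ, ‖φ a‖)
  refine ((Embeddings.finite_of_norm_le F ℂ (‖(d : ℂ)‖ * B)).preimage hinj.injOn).subset ?_
  rintro x ⟨n, hn, rfl⟩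
  refine ⟨.of_pow (Nat.pos_of_ne_zero hn) ?_, fun φ ↦ ?_⟩
  · rw [smul_pow, ← Nat.succ_pred_eq_of_ne_zero hn, pow_succ d, mul_smul]
    rw [← Nat.succ_pred_eq_of_ne_zero hn] at hd
    exact hd.smul _
  · simp only [zsmul_eq_mul, map_mul, map_intCast, norm_mul]
    gcongr
    by_contra! h
    have h₁ : 1 < ‖φ x‖ := (le_max_left _ _).trans_lt h
    have h₂ : ‖φ (x ^ n)‖ ≤ B :=
      (Finset.single_le_sum (f := fun ψ : F →+* ℂ ↦ ‖ψ (x ^ n)‖) (fun _ _ ↦ norm_nonneg _)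
        (Finset.mem_univ φ)).trans (le_max_right _ _)
    rw [map_pow, norm_pow] at h₂
    exact (h.trans_le (le_self_pow₀ h₁.le hn)).not_ge h₂

/-- An algebraic element of a finitely generated extension of `ℚ` has only finitely many roots
of any order. -/
theorem finite_setOf_exists_pow_eq_of_isAlgebraic {E : Type*} [Field E] [Algebra ℚ E]
    [Algebra.EssFiniteType ℚ E] {r : E} (hr : IsAlgebraic ℚ r) :
    {x : E | ∃ n ≠ 0, x ^ n = r}.Finite := by
  have : CharZero (algebraicClosure ℚ E) := algebraRat.charZero _
  have := finiteDimensional_algebraicClosure_of_essFiniteType ℚ E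
  have : NumberField (algebraicClosure ℚ E) :=
    { to_finiteDimensional := by convert! this; exact Subsingleton.elim _ _ }
  let r' : algebraicClosure ℚ E := ⟨r, mem_algebraicClosure_iff.mpr hr⟩
  refine ((NumberField.finite_setOf_exists_pow_eq _ r').image (↑)).subset ?_
  rintro x ⟨n, hn, rfl⟩
  exact ⟨⟨x, mem_algebraicClosure_iff.mpr (hr.of_pow (Nat.pos_of_ne_zero hn))⟩,
    ⟨n, hn, Subtype.ext rfl⟩, rfl⟩

/-- If `K ⊆ ℝ` is a finitely generated field extension of `ℚ` and `r ∈ K` is positive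
with `r ≠ 1`, then `K` contains only finitely many of the positive real roots
`r ^ (1/n)`. -/
theorem finitely_many_roots_in_fg_field (K : IntermediateField ℚ ℝ) (hK : K.FG)
    (r : ℝ) (hrK : r ∈ K) (hr0 : 0 < r) (hr1 : r ≠ 1) :
    {n : ℕ | 1 ≤ n ∧ r ^ ((n : ℝ)⁻¹) ∈ K}.Finite := by
  have : Algebra.EssFiniteType ℚ K := IntermediateField.essFiniteType_iff.mpr hK
  have hpow (n : ℕ) (hn : 1 ≤ n) : (r ^ ((n : ℝ)⁻¹)) ^ n = r :=
    Real.rpow_inv_natCast_pow hr0.le (by lia)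
  by_cases hr : IsAlgebraic ℚ (⟨r, hrK⟩ : K)
  · refine Set.Finite.of_finite_image (f := fun n : ℕ ↦ r ^ ((n : ℝ)⁻¹))
      (((finite_setOf_exists_pow_eq_of_isAlgebraic hr).image (↑)).subset ?_) ?_
    · rintro _ ⟨n, ⟨hn, hmem⟩, rfl⟩
      exact ⟨⟨_, hmem⟩, ⟨n, by lia, Subtype.ext (hpow n hn)⟩, rfl⟩
    · intro m _ n _ h
      simpa [Real.rpow_right_inj hr0 hr1] using h
  · refine (finite_setOf_exists_pow_eq_of_transcendental (k := ℚ) hr).subset ?_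
    rintro n ⟨hn, hmem⟩
    exact ⟨⟨_, hmem⟩, Subtype.ext (hpow n hn)⟩
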